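/- Suppose n ≥ 2, max{−λ₂, 0} < −λ₁ and r₁ ≠ 0. Then problem (P+) has a local-nonglobal minimizer y* with a positive Lagrangian multiplier, i.e., a local-nonglobal minimizer y* together with some μ* > 0 satisfying (I + μ*A)y* + μ*b = 0, if and only if there exists η̃ ∈ (max{−λ₂, 0}, −λ₁) such that ψ₁(η̃) > 0. -/

import Mathlib

open Matrix Finset

/-- Euclidean norm of a vector in `Fin n → ℝ`. -/
noncomputable def euclNorm {n : ℕ} (x : Fin n → ℝ) : ℝ := Real.sqrt (x ⬝ᵥ x)

/-- The quadratic constraint `g(y) = yᵀAy + 2bᵀy + c`. -/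
noncomputable def gq {n : ℕ} (A : Matrix (Fin n) (Fin n) ℝ) (b : Fin n → ℝ) (c : ℝ)
    (y : Fin n → ℝ) : ℝ := y ⬝ᵥ A.mulVec y + 2 * (b ⬝ᵥ y) + c

/-- Local-nonglobal minimizer of problem (P+): minimize `‖y‖²` subject to `g(y) = 0`. -/
def IsLNGMinPplus {n : ℕ} (A : Matrix (Fin n) (Fin n) ℝ) (b : Fin n → ℝ) (c : ℝ)
    (ys : Fin n → ℝ) : Prop :=
  (gq A b c ys = 0 ∧ ∃ δ > (0:ℝ), ∀ y : Fin n → ℝ,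
      gq A b c y = 0 → euclNorm (y - ys) < δ → ys ⬝ᵥ ys ≤ y ⬝ᵥ y) ∧
  ¬ (∀ y : Fin n → ℝ, gq A b c y = 0 → ys ⬝ᵥ ys ≤ y ⬝ᵥ y)

/-- Local-nonglobal minimizer of problem (P−): minimize `−‖y‖²` subject to `g(y) = 0`. -/
def IsLNGMinPminus {n : ℕ} (A : Matrix (Fin n) (Fin n) ℝ) (b : Fin n → ℝ) (c : ℝ)
    (ys : Fin n → ℝ) : Prop :=
  (gq A b c ys = 0 ∧ ∃ δ > (0:ℝ), ∀ y : Fin n → ℝ,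
      gq A b c y = 0 → euclNorm (y - ys) < δ → -(ys ⬝ᵥ ys) ≤ -(y ⬝ᵥ y)) ∧
  ¬ (∀ y : Fin n → ℝ, gq A b c y = 0 → -(ys ⬝ᵥ ys) ≤ -(y ⬝ᵥ y))

/-- `ψ₁(η) = ∑ᵢ λᵢrᵢ²/(λᵢ+η)² − ∑ᵢ 2rᵢ²/(λᵢ+η) + c`. -/
noncomputable def psiOne {n : ℕ} (lam : Fin n → ℝ) (v : Fin n → Fin n → ℝ) (b : Fin n → ℝ)
    (c : ℝ) (η : ℝ) : ℝ :=
  (∑ i : Fin n, lam i * (v i ⬝ᵥ b) ^ 2 / (lam i + η) ^ 2) -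
    (∑ i : Fin n, 2 * (v i ⬝ᵥ b) ^ 2 / (lam i + η)) + c

section Diagonal

variable {n : ℕ} {lam r x : Fin n → ℝ} {c η : ℝ}

theorem gq_diagonal (lam r : Fin n → ℝ) (c : ℝ) (x : Fin n → ℝ) :
    gq (diagonal lam) r c x = ∑ i, (lam i * x i ^ 2 + 2 * r i * x i) + c := by
  simp only [gq, dotProduct, mulVec_diagonal, Finset.mul_sum, ← Finset.sum_add_distrib]
  congr 1
  exact Finset.sum_congr rfl fun i _ => by ring

theorem gq_diagonal_add (hx : ∀ i, (lam i + η) * x i = -r i) (d : Fin n → ℝ) :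
    gq (diagonal lam) r c (x + d) =
      gq (diagonal lam) r c x + (∑ i, lam i * d i ^ 2 - 2 * η * ∑ i, x i * d i) := by
  rw [gq_diagonal, gq_diagonal, Finset.mul_sum, ← Finset.sum_sub_distrib, add_right_comm,
    ← Finset.sum_add_distrib]
  congr 1
  refine Finset.sum_congr rfl fun i _ => ?_
  have hr : r i = -((lam i + η) * x i) := by rw [hx]; ring
  rw [hr, Pi.add_apply]
  ring

theorem mul_dotProduct_add_sub (d : Fin n → ℝ)
    (hd : ∑ i, lam i * d i ^ 2 = 2 * η * ∑ i, x i * d i) :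
    η * ((x + d) ⬝ᵥ (x + d) - x ⬝ᵥ x) = ∑ i, (lam i + η) * d i ^ 2 := by
  have h : ∑ i, (lam i + η) * d i ^ 2 = ∑ i, lam i * d i ^ 2 + η * ∑ i, d i ^ 2 := by
    rw [Finset.mul_sum, ← Finset.sum_add_distrib]
    exact Finset.sum_congr rfl fun i _ => by ring
  rw [h, hd]
  simp only [dotProduct, Finset.mul_sum, ← Finset.sum_add_distrib, ← Finset.sum_sub_distrib]
  exact Finset.sum_congr rfl fun i _ => by rw [Pi.add_apply]; ring

theorem euclNorm_lt_iff (d : Fin n → ℝ) {δ : ℝ} (hδ : 0 < δ) :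
    euclNorm d < δ ↔ ∑ i, d i ^ 2 < δ ^ 2 := by
  rw [euclNorm, Real.sqrt_lt' hδ]
  simp only [dotProduct, sq]

/-- At a feasible stationary point with multiplier `1 / η`, being a local-nonglobal minimizer is a
condition on the sign of `∑ i, (lam i + η) * d i ^ 2` over the feasible displacements `d`. -/
theorem isLNGMinPplus_diagonal_iff (hη : 0 < η) (hx : ∀ i, (lam i + η) * x i = -r i)
    (hg : gq (diagonal lam) r c x = 0) :
    IsLNGMinPplus (diagonal lam) r c x ↔
      (∃ δ > (0 : ℝ), ∀ d : Fin n → ℝ, ∑ i, lam i * d i ^ 2 = 2 * η * ∑ i, x i * d i →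
        ∑ i, d i ^ 2 < δ → 0 ≤ ∑ i, (lam i + η) * d i ^ 2) ∧
      ∃ d : Fin n → ℝ, ∑ i, lam i * d i ^ 2 = 2 * η * ∑ i, x i * d i ∧
        ∑ i, (lam i + η) * d i ^ 2 < 0 := by
  have hfeas (d : Fin n → ℝ) : gq (diagonal lam) r c (x + d) = 0 ↔
      ∑ i, lam i * d i ^ 2 = 2 * η * ∑ i, x i * d i := by
    rw [gq_diagonal_add hx, hg, zero_add, sub_eq_zero]
  have hle (d : Fin n → ℝ) (hd : ∑ i, lam i * d i ^ 2 = 2 * η * ∑ i, x i * d i) :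
      x ⬝ᵥ x ≤ (x + d) ⬝ᵥ (x + d) ↔ 0 ≤ ∑ i, (lam i + η) * d i ^ 2 := by
    rw [← mul_dotProduct_add_sub d hd, mul_nonneg_iff_of_pos_left hη, sub_nonneg]
  constructor
  · rintro ⟨⟨-, δ, hδ, hloc⟩, hglob⟩
    refine ⟨⟨δ ^ 2, by positivity, fun d hd hdδ => ?_⟩, ?_⟩
    · refine (hle d hd).1 (hloc _ ((hfeas d).2 hd) ?_)
      rwa [add_sub_cancel_left, euclNorm_lt_iff d hδ]
    · push Not at hglob
      obtain ⟨y, hy, hlt⟩ := hglob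
      obtain ⟨d, rfl⟩ : ∃ d, y = x + d := ⟨y - x, by abel⟩
      have hd := (hfeas d).1 hy
      exact ⟨d, hd, not_le.1 fun h => hlt.not_ge ((hle d hd).2 h)⟩
  · rintro ⟨⟨δ, hδ, hloc⟩, d, hd, hneg⟩
    refine ⟨⟨hg, √δ, Real.sqrt_pos.2 hδ, fun y hy hyδ => ?_⟩, fun h =>
      hneg.not_ge ((hle d hd).1 (h _ ((hfeas d).2 hd)))⟩
    obtain ⟨d, rfl⟩ : ∃ d, y = x + d := ⟨y - x, by abel⟩
    have hd := (hfeas d).1 hy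
    rw [add_sub_cancel_left, euclNorm_lt_iff d (Real.sqrt_pos.2 hδ), Real.sq_sqrt hδ.le] at hyδ
    exact (hle d hd).2 (hloc d hd hyδ)

open Filter Topology in
/-- Local minimality forces the Lagrangian Hessian to be nonnegative on `u + ε • w` for small
`ε ≠ 0`, where `u` is tangent to the constraint and `w` is transversal to it. -/
theorem eventually_nonneg_of_local_min {δ : ℝ} (hη : η ≠ 0) (hδ : 0 < δ)
    (hloc : ∀ d : Fin n → ℝ, ∑ i, lam i * d i ^ 2 = 2 * η * ∑ i, x i * d i →
      ∑ i, d i ^ 2 < δ → 0 ≤ ∑ i, (lam i + η) * d i ^ 2)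
    {u w : Fin n → ℝ} (hu : ∑ i, x i * u i = 0) (hw : ∑ i, x i * w i ≠ 0)
    (hq : ∑ i, lam i * u i ^ 2 ≠ 0) :
    ∀ᶠ ε in 𝓝[≠] (0 : ℝ), 0 ≤ ∑ i, (lam i + η) * (u i + ε * w i) ^ 2 := by
  set q : ℝ → ℝ := fun ε => ∑ i, lam i * (u i + ε * w i) ^ 2 with hqdef
  set t : ℝ → ℝ := fun ε => 2 * η * (ε * ∑ i, x i * w i) / q ε with htdef
  have hq0 : q 0 ≠ 0 := by simpa [hqdef] using hq
  have hqc : Continuous q := by fun_prop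
  have htc : ContinuousAt t 0 := by
    refine ContinuousAt.div ?_ hqc.continuousAt hq0
    fun_prop
  have hnorm : ContinuousAt (fun ε => ∑ i, (t ε * (u i + ε * w i)) ^ 2) 0 := by
    fun_prop
  have hsmall : ∀ᶠ ε in 𝓝 (0 : ℝ), ∑ i, (t ε * (u i + ε * w i)) ^ 2 < δ :=
    hnorm.eventually_lt continuousAt_const (by simpa [htdef] using hδ)
  have hqne : ∀ᶠ ε in 𝓝 (0 : ℝ), q ε ≠ 0 := hqc.continuousAt.eventually_ne hq0
  filter_upwards [hsmall.filter_mono nhdsWithin_le_nhds, hqne.filter_mono nhdsWithin_le_nhds,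
    self_mem_nhdsWithin] with ε hε hqε hε0
  have ht : t ε ≠ 0 := by
    refine div_ne_zero (mul_ne_zero (mul_ne_zero two_ne_zero hη) (mul_ne_zero hε0 hw)) hqε
  have hpull (a : Fin n → ℝ) : ∑ i, a i * (t ε * (u i + ε * w i)) ^ 2 =
      t ε ^ 2 * ∑ i, a i * (u i + ε * w i) ^ 2 := by
    rw [Finset.mul_sum]
    exact Finset.sum_congr rfl fun i _ => by ring
  have hlin : ∑ i, x i * (t ε * (u i + ε * w i)) = t ε * (ε * ∑ i, x i * w i) := by
    have : ∑ i, x i * (t ε * (u i + ε * w i)) =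
        t ε * (∑ i, x i * u i + ε * ∑ i, x i * w i) := by
      rw [Finset.mul_sum, ← Finset.sum_add_distrib, Finset.mul_sum]
      exact Finset.sum_congr rfl fun i _ => by ring
    rw [this, hu, zero_add]
  have hfeas : ∑ i, lam i * (t ε * (u i + ε * w i)) ^ 2 =
      2 * η * ∑ i, x i * (t ε * (u i + ε * w i)) := by
    rw [hpull, hlin]
    have : t ε * q ε = 2 * η * (ε * ∑ i, x i * w i) := div_mul_cancel₀ _ hqε
    linear_combination t ε * this
  have := hloc _ hfeas hε
  rw [hpull] at this
  exact (mul_nonneg_iff_of_pos_left (by positivity)).1 this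

/-- A diagonal form with a single negative coefficient, corrected by a multiple of the square of a
linear form, is nonnegative. -/
theorem sq_dotProduct_div_le {a x : Fin n → ℝ} {k : Fin n} (hk : a k < 0)
    (ha : ∀ i ≠ k, 0 < a i) (hS : ∑ i, x i ^ 2 / a i < 0) (d : Fin n → ℝ) :
    (∑ i, x i * d i) ^ 2 / ∑ i, x i ^ 2 / a i ≤ ∑ i, a i * d i ^ 2 := by
  rw [div_le_iff_of_neg hS]
  rw [← Finset.add_sum_erase _ _ (Finset.mem_univ k)] at hS ⊢
  rw [← Finset.add_sum_erase _ _ (Finset.mem_univ k),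
    ← Finset.add_sum_erase _ (fun i => x i * d i) (Finset.mem_univ k)]
  have hcs : (∑ i ∈ univ.erase k, x i * d i) ^ 2 ≤
      (∑ i ∈ univ.erase k, x i ^ 2 / a i) * ∑ i ∈ univ.erase k, a i * d i ^ 2 := by
    refine Finset.sum_sq_le_sum_mul_sum_of_sq_le_mul _ (fun i hi => ?_) (fun i hi => ?_)
      (fun i hi => ?_)
    · have := ha i (Finset.ne_of_mem_erase hi)
      positivity
    · have := ha i (Finset.ne_of_mem_erase hi)
      positivity
    · have := (ha i (Finset.ne_of_mem_erase hi)).ne'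
      exact le_of_eq (by field_simp)
  have hT : 0 ≤ ∑ i ∈ univ.erase k, x i ^ 2 / a i := Finset.sum_nonneg fun i hi => by
    have := ha i (Finset.ne_of_mem_erase hi)
    positivity
  have hR : 0 ≤ ∑ i ∈ univ.erase k, a i * d i ^ 2 := Finset.sum_nonneg fun i hi => by
    have := ha i (Finset.ne_of_mem_erase hi)
    positivity
  generalize ∑ i ∈ univ.erase k, x i ^ 2 / a i = T at *
  generalize ∑ i ∈ univ.erase k, a i * d i ^ 2 = R at *
  generalize ∑ i ∈ univ.erase k, x i * d i = m at *
  obtain ⟨z, hz⟩ : ∃ z, x k = a k * z := ⟨x k / a k, (mul_div_cancel₀ _ hk.ne).symm⟩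
  have hz2 : x k ^ 2 / a k = a k * z ^ 2 := by
    have := hk.ne
    rw [hz]
    field_simp
  rw [hz2] at hS ⊢
  rw [hz]
  generalize a k = α at *
  generalize d k = e at *
  suffices 0 ≤ (-α * z ^ 2 - T) * R + m ^ 2 + 2 * (α * z * e * m) - α * T * e ^ 2 by
    nlinarith
  rcases hT.eq_or_lt with rfl | hTpos
  · have hm : m = 0 := by nlinarith
    subst hm
    nlinarith
  · refine nonneg_of_mul_nonneg_right (a := T) ?_ hTpos
    have h := mul_nonneg (sub_nonneg.2 hcs) (by linarith : 0 ≤ -α * z ^ 2 - T)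
    have h' : 0 ≤ -α * (z * m - T * e) ^ 2 := mul_nonneg (by linarith) (sq_nonneg _)
    nlinarith

open Filter Topology in
/-- Second-order sufficient condition for the displacement form of local minimality. -/
theorem exists_local_min_radius {k : Fin n} (hη : 0 < η) (hk : lam k + η < 0)
    (hpos : ∀ i ≠ k, 0 < lam i + η) (hS : ∑ i, x i ^ 2 / (lam i + η) < 0) :
    ∃ δ > (0 : ℝ), ∀ d : Fin n → ℝ, ∑ i, lam i * d i ^ 2 = 2 * η * ∑ i, x i * d i →
      ∑ i, d i ^ 2 < δ → 0 ≤ ∑ i, (lam i + η) * d i ^ 2 := by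
  have hne (i : Fin n) : lam i + η ≠ 0 := by
    by_cases h : i = k
    · exact h ▸ hk.ne
    · exact (hpos i h).ne'
  obtain ⟨ε, ⟨hεS, hεpos⟩, hε⟩ : ∃ ε : ℝ, (∑ i, x i ^ 2 / (lam i + η - ε) < 0 ∧
      ∀ i, i ≠ k → 0 < lam i + η - ε) ∧ 0 < ε := by
    have h1 : ∀ᶠ ε in 𝓝 (0 : ℝ), ∑ i, x i ^ 2 / (lam i + η - ε) < 0 := by
      have hc : ContinuousAt (fun ε => ∑ i, x i ^ 2 / (lam i + η - ε)) 0 := by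
        refine tendsto_finsetSum _ fun i _ => ?_
        refine ContinuousAt.div (by fun_prop) (by fun_prop) (by simpa using hne i)
      exact hc.eventually_lt continuousAt_const (by simpa using hS)
    have h2 : ∀ᶠ ε in 𝓝 (0 : ℝ), ∀ i, i ≠ k → 0 < lam i + η - ε := by
      refine eventually_all.2 fun i => ?_
      by_cases h : i = k
      · exact .of_forall fun _ h' => absurd h h'
      · filter_upwards [eventually_lt_nhds (hpos i h)] with ε hε _
        linarith
    exact (((h1.and h2).filter_mono nhdsWithin_le_nhds).and
      (self_mem_nhdsWithin (s := Set.Ioi (0 : ℝ)))).exists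
  set S := ∑ i, x i ^ 2 / (lam i + η - ε)
  set L := ∑ i, |lam i| with hL
  set K := L ^ 2 / (4 * η ^ 2 * -S) with hK
  have hK0 : 0 ≤ K := by
    have : 0 < -S := by linarith
    positivity
  refine ⟨ε / (K + 1), by positivity, fun d hd hdδ => ?_⟩
  set N := ∑ i, d i ^ 2 with hN
  have hN0 : 0 ≤ N := Finset.sum_nonneg fun i _ => sq_nonneg _
  have hlow := sq_dotProduct_div_le (a := fun i => lam i + η - ε) (x := x) (k := k)
    (by linarith) hεpos hεS d
  have hsplit : ∑ i, (lam i + η - ε) * d i ^ 2 = ∑ i, (lam i + η) * d i ^ 2 - ε * N := by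
    rw [hN, Finset.mul_sum, ← Finset.sum_sub_distrib]
    exact Finset.sum_congr rfl fun i _ => by ring
  have hq : |∑ i, lam i * d i ^ 2| ≤ L * N := by
    refine (Finset.abs_sum_le_sum_abs _ _).trans ?_
    rw [hL, Finset.sum_mul]
    refine Finset.sum_le_sum fun i hi => ?_
    rw [abs_mul, abs_of_nonneg (sq_nonneg (d i))]
    exact mul_le_mul_of_nonneg_left
      (Finset.single_le_sum (f := fun j => d j ^ 2) (fun j _ => sq_nonneg _) hi) (abs_nonneg _)
  have hxd : (∑ i, x i * d i) ^ 2 ≤ L ^ 2 * N ^ 2 / (4 * η ^ 2) := by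
    rw [le_div_iff₀ (by positivity)]
    have := sq_le_sq' (neg_le_of_abs_le hq) (le_of_abs_le hq)
    rw [hd] at this
    nlinarith
  have hbound : -(K * N ^ 2) ≤ (∑ i, x i * d i) ^ 2 / S := by
    rw [le_div_iff_of_neg hεS]
    refine hxd.trans (le_of_eq ?_)
    rw [hK]
    have := hεS.ne
    field_simp
  have hKN : (K + 1) * N < ε := by
    rwa [lt_div_iff₀ (by positivity), mul_comm] at hdδ
  have : 0 ≤ N * (ε - (K + 1) * N) := mul_nonneg hN0 (by linarith)
  rw [hsplit] at hlow
  nlinarith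

/-- Constraint value along the curve of stationary points, for a diagonal quadratic. -/
noncomputable def secular (lam r : Fin n → ℝ) (c η : ℝ) : ℝ :=
  ∑ i, (lam i * r i ^ 2 / (lam i + η) ^ 2 - 2 * r i ^ 2 / (lam i + η)) + c

theorem gq_diagonal_eq_secular (hx : ∀ i, (lam i + η) * x i = -r i)
    (hne : ∀ i, lam i + η ≠ 0) : gq (diagonal lam) r c x = secular lam r c η := by
  rw [gq_diagonal, secular]
  congr 1
  refine Finset.sum_congr rfl fun i _ => ?_
  have hr : r i = -((lam i + η) * x i) := by rw [hx]; ring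
  rw [hr]
  have := hne i
  field_simp
  ring

theorem hasDerivAt_secular (hne : ∀ i, lam i + η ≠ 0) :
    HasDerivAt (secular lam r c) (2 * η * ∑ i, r i ^ 2 / (lam i + η) ^ 3) η := by
  unfold secular
  rw [Finset.mul_sum]
  refine (HasDerivAt.fun_sum fun i _ => ?_).add_const c
  have h : HasDerivAt (fun t => lam i + t) 1 η := (hasDerivAt_id η).const_add _
  have := (((h.fun_pow 2).fun_inv (pow_ne_zero 2 (hne i))).const_mul (lam i * r i ^ 2)).fun_sub
    ((h.fun_inv (hne i)).const_mul (2 * r i ^ 2))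
  simp only [← div_eq_mul_inv] at this
  refine this.congr_deriv ?_
  have := hne i
  field_simp
  ring

theorem sum_div_cube_le {k : Fin n} {ξ : ℝ} (hξη : ξ ≤ η) (hk : lam k + η < 0)
    (hpos : ∀ i ≠ k, 0 < lam i + ξ) :
    ∑ i, r i ^ 2 / (lam i + η) ^ 3 ≤ ∑ i, r i ^ 2 / (lam i + ξ) ^ 3 := by
  refine Finset.sum_le_sum fun i _ => ?_
  have hodd : Odd 3 := by decide
  have hle : (lam i + ξ) ^ 3 ≤ (lam i + η) ^ 3 := hodd.pow_le_pow.2 (by linarith)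
  simp only [div_eq_mul_inv]
  refine mul_le_mul_of_nonneg_left ?_ (sq_nonneg _)
  by_cases h : i = k
  · subst h
    exact (inv_le_inv_of_neg (hodd.pow_neg hk) (hodd.pow_neg (by linarith))).2 hle
  · exact inv_anti₀ (pow_pos (hpos i h) 3) hle

/-- The secular function is negative near the pole `-lam k`, so it vanishes to the right of a
point where it is positive. -/
theorem exists_secular_eq_zero {k : Fin n} {t : ℝ} (hk0 : lam k < 0) (hk : lam k + t < 0)
    (hpos : ∀ i ≠ k, 0 < lam i + t) (hr : r k ≠ 0) (ht : 0 < secular lam r c t) :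
    ∃ η, t < η ∧ lam k + η < 0 ∧ secular lam r c η = 0 := by
  set F : ℝ → ℝ := fun s => lam k * r k ^ 2 - 2 * r k ^ 2 * (lam k + s) + (lam k + s) ^ 2 *
    (∑ i ∈ univ.erase k, (lam i * r i ^ 2 / (lam i + s) ^ 2 - 2 * r i ^ 2 / (lam i + s)) + c)
    with hF
  have hFs {s : ℝ} (hs : lam k + s ≠ 0) : F s = (lam k + s) ^ 2 * secular lam r c s := by
    rw [hF, secular, ← Finset.add_sum_erase _ _ (Finset.mem_univ k)]
    field_simp
    ring
  have hcont : ContinuousOn F (Set.Icc t (-lam k)) := by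
    have hsum : ContinuousOn (fun s => ∑ i ∈ univ.erase k,
        (lam i * r i ^ 2 / (lam i + s) ^ 2 - 2 * r i ^ 2 / (lam i + s)))
        (Set.Icc t (-lam k)) := by
      refine continuousOn_finsetSum _ fun i hi => ?_
      have hne : ∀ s ∈ Set.Icc t (-lam k), lam i + s ≠ 0 := fun s hs => by
        have := hpos i (Finset.ne_of_mem_erase hi)
        have := hs.1
        linarith
      exact (ContinuousOn.div (by fun_prop) (by fun_prop) fun s hs => pow_ne_zero 2 (hne s hs)).sub
        (ContinuousOn.div (by fun_prop) (by fun_prop) hne)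
    fun_prop
  have h1 : F (-lam k) < 0 := by
    simp only [hF, add_neg_cancel]
    have : 0 < r k ^ 2 := by positivity
    nlinarith
  have h2 : 0 < F t := by
    rw [hFs hk.ne]
    have := hk.ne
    positivity
  obtain ⟨η, ⟨hη1, hη2⟩, hη⟩ := intermediate_value_Ioo' (by linarith) hcont ⟨h1, h2⟩
  have hneg : lam k + η < 0 := by linarith
  refine ⟨η, hη1, hneg, ?_⟩
  rw [hFs hneg.ne] at hη
  exact (mul_eq_zero.1 hη).resolve_left (pow_ne_zero 2 hneg.ne)

open Filter Topology in
/-- A differentiable function with nonzero derivative at a zero is positive somewhere near it. -/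
theorem exists_pos_of_hasDerivAt_ne_zero {f : ℝ → ℝ} {f' t : ℝ} (hf : HasDerivAt f f' t)
    (hf' : f' ≠ 0) (h0 : f t = 0) {s : Set ℝ} (hs : s ∈ 𝓝 t) : ∃ u ∈ s, 0 < f u := by
  by_contra! h
  have hmax : IsLocalMax f t := by
    filter_upwards [hs] with u hu
    exact (h u hu).trans h0.ge
  exact hf' (hmax.hasDerivAt_eq_zero hf)

/-- The multiplier of a local-nonglobal minimizer lies strictly between the two extreme poles. -/
theorem multiplier_mem_of_isLNGMinPplus {k l : Fin n} (hkl : l ≠ k) (hmin : ∀ i, lam k ≤ lam i)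
    (hr : r k ≠ 0) (hη : 0 < η) (hx : ∀ i, (lam i + η) * x i = -r i)
    (hlng : IsLNGMinPplus (diagonal lam) r c x) : lam k + η < 0 ∧ 0 < lam l + η := by
  obtain ⟨⟨δ, hδ, hloc⟩, d, hd, hneg⟩ :=
    (isLNGMinPplus_diagonal_iff hη hx hlng.1.1).1 hlng
  have hxk : x k ≠ 0 := fun h => hr (by have := hx k; simp_all)
  have hk : lam k + η < 0 := by
    by_contra! h
    refine hneg.not_ge (Finset.sum_nonneg fun i _ => mul_nonneg ?_ (sq_nonneg _))
    linarith [hmin i]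
  refine ⟨hk, ?_⟩
  by_contra! hl
  set u : Fin n → ℝ := Pi.single k (-x l) + Pi.single l (x k) with hu
  set w : Fin n → ℝ := Pi.single k 1 with hw
  have hsum (f : Fin n → ℝ) (hf : ∀ i, i ≠ k → i ≠ l → f i = 0) : ∑ i, f i = f k + f l :=
    Fintype.sum_eq_add k l hkl.symm fun i hi => hf i hi.1 hi.2
  have huk : u k = -x l := by simp [hu, hkl.symm]
  have hul : u l = x k := by simp [hu, hkl]
  have hu0 (i : Fin n) (h1 : i ≠ k) (h2 : i ≠ l) : u i = 0 := by simp [hu, h1, h2]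
  have hwk : w k = 1 := by simp [hw]
  have hw0 (i : Fin n) (h1 : i ≠ k) : w i = 0 := by simp [hw, h1]
  have hev := eventually_nonneg_of_local_min hη.ne' hδ hloc (u := u) (w := w)
    (by
      rw [hsum _ fun i h1 h2 => by rw [hu0 i h1 h2, mul_zero], huk, hul]
      ring)
    (by
      rw [hsum _ fun i h1 h2 => by rw [hw0 i h1, mul_zero], hwk, hw0 l hkl]
      simpa using hxk)
    (by
      rw [hsum _ fun i h1 h2 => by rw [hu0 i h1 h2]; ring, huk, hul]
      have : 0 < x k ^ 2 := by positivity
      nlinarith [sq_nonneg (x l)])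
  have hne : ∀ᶠ ε in nhdsWithin (0 : ℝ) {0}ᶜ, ε ≠ x l := by
    by_cases h : x l = 0
    · rw [h]
      exact self_mem_nhdsWithin
    · exact (eventually_ne_nhds (Ne.symm h)).filter_mono nhdsWithin_le_nhds
  obtain ⟨ε, hε, hεl⟩ := (hev.and hne).exists
  rw [hsum _ fun i h1 h2 => by rw [hu0 i h1 h2, hw0 i h1]; ring, huk, hul, hwk, hw0 l hkl] at hε
  have : 0 < (ε - x l) ^ 2 := by
    have := sub_ne_zero.2 hεl
    positivity
  nlinarith [sq_nonneg (x k)]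

/-- A local-nonglobal minimizer is a nondegenerate zero of the secular function. -/
theorem sum_div_cube_ne_zero_of_isLNGMinPplus {k : Fin n} (hr : r k ≠ 0) (hη : 0 < η)
    (hne : ∀ i, lam i + η ≠ 0) (hx : ∀ i, (lam i + η) * x i = -r i)
    (hlng : IsLNGMinPplus (diagonal lam) r c x) :
    ∑ i, r i ^ 2 / (lam i + η) ^ 3 ≠ 0 := by
  intro hφ
  obtain ⟨⟨δ, hδ, hloc⟩, -⟩ := (isLNGMinPplus_diagonal_iff hη hx hlng.1.1).1 hlng
  have hxk : x k ≠ 0 := fun h => hr (by have := hx k; simp_all)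
  have hri (i : Fin n) : r i = -((lam i + η) * x i) := by rw [hx]; ring
  have hφ' : ∑ i, x i ^ 2 / (lam i + η) = 0 := by
    rw [← hφ]
    refine Finset.sum_congr rfl fun i _ => ?_
    have := hne i
    rw [hri]
    field_simp
  set X := ∑ i, x i ^ 2 with hX
  have hXpos : 0 < X :=
    Finset.sum_pos' (fun i _ => sq_nonneg _) ⟨k, Finset.mem_univ k, by positivity⟩
  set u : Fin n → ℝ := fun i => x i / (lam i + η) with hu
  have huQ : ∑ i, (lam i + η) * u i ^ 2 = 0 := by
    rw [← hφ']
    refine Finset.sum_congr rfl fun i _ => ?_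
    have := hne i
    simp only [hu]
    field_simp
  have huN : 0 < ∑ i, u i ^ 2 :=
    Finset.sum_pos' (fun i _ => sq_nonneg _) ⟨k, Finset.mem_univ k, by
      have := hne k
      simp only [hu]
      positivity⟩
  have hev := eventually_nonneg_of_local_min hη.ne' hδ hloc (u := u) (w := x)
    (by
      rw [← hφ']
      exact Finset.sum_congr rfl fun i _ => by simp only [hu]; ring)
    (by simpa only [← sq] using hXpos.ne')
    (by
      have : ∑ i, (lam i + η) * u i ^ 2 = ∑ i, lam i * u i ^ 2 + η * ∑ i, u i ^ 2 := by
        rw [Finset.mul_sum, ← Finset.sum_add_distrib]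
        exact Finset.sum_congr rfl fun i _ => by ring
      have := mul_pos hη huN
      linarith)
  set Y := ∑ i, (lam i + η) * x i ^ 2 with hY
  have hexp (ε : ℝ) : ∑ i, (lam i + η) * (u i + ε * x i) ^ 2 = ε * (2 * X + ε * Y) := by
    have : ∑ i, (lam i + η) * (u i + ε * x i) ^ 2 =
        ∑ i, (lam i + η) * u i ^ 2 + ε * (2 * X + ε * Y) := by
      rw [hX, hY, Finset.mul_sum, Finset.mul_sum, ← Finset.sum_add_distrib, Finset.mul_sum,
        ← Finset.sum_add_distrib]
      refine Finset.sum_congr rfl fun i _ => ?_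
      have := hne i
      simp only [hu]
      field_simp
      ring
    rw [this, huQ, zero_add]
  have hfac : ∀ᶠ ε in nhds (0 : ℝ), 0 < 2 * X + ε * Y := by
    have hc : ContinuousAt (fun ε : ℝ => 2 * X + ε * Y) 0 := by fun_prop
    exact continuousAt_const.eventually_lt hc (by simpa using hXpos)
  have hleft : nhdsWithin (0 : ℝ) (Set.Iio 0) ≤ nhdsWithin 0 {0}ᶜ :=
    nhdsWithin_mono _ fun ε hε => ne_of_lt hε
  obtain ⟨ε, ⟨h1, h2⟩, h3⟩ := (((hev.filter_mono hleft).and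
    (hfac.filter_mono nhdsWithin_le_nhds)).and self_mem_nhdsWithin).exists
  rw [hexp] at h1
  exact h1.not_gt (mul_neg_of_neg_of_pos h3 h2)

/-- The characterization of local-nonglobal minimizers for a diagonal quadratic constraint. -/
theorem exists_isLNGMinPplus_diagonal_iff {k l : Fin n} (hkl : l ≠ k)
    (hmin : ∀ i, lam k ≤ lam i) (hl : ∀ i ≠ k, lam l ≤ lam i)
    (hk0 : lam k < 0) (hr : r k ≠ 0) :
    (∃ (x : Fin n → ℝ) (μ : ℝ), IsLNGMinPplus (diagonal lam) r c x ∧ 0 < μ ∧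
        ∀ i, x i + μ * (lam i * x i) + μ * r i = 0) ↔
    ∃ η, max (-lam l) 0 < η ∧ η < -lam k ∧ 0 < secular lam r c η := by
  have hne {η : ℝ} (hlη : -lam l < η) (hηk : η < -lam k) (i : Fin n) : lam i + η ≠ 0 := by
    by_cases h : i = k
    · subst h
      linarith
    · linarith [hl i h]
  constructor
  · rintro ⟨x, μ, hlng, hμ, hstat⟩
    set η := μ⁻¹
    have hη : 0 < η := inv_pos.2 hμ
    have hx (i : Fin n) : (lam i + η) * x i = -r i := by
      have hμη : η * μ = 1 := inv_mul_cancel₀ hμ.ne'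
      linear_combination η * hstat i - (lam i * x i + r i) * hμη
    obtain ⟨hk, hlη⟩ := multiplier_mem_of_isLNGMinPplus hkl hmin hr hη hx hlng
    have hmem : η ∈ Set.Ioo (max (-lam l) 0) (-lam k) :=
      ⟨max_lt (by linarith) hη, by linarith⟩
    have hne' := hne (η := η) (by linarith) hmem.2
    have hφ := sum_div_cube_ne_zero_of_isLNGMinPplus hr hη hne' hx hlng
    obtain ⟨t, ht, htpos⟩ := exists_pos_of_hasDerivAt_ne_zero (hasDerivAt_secular (c := c) hne')
      (mul_ne_zero (mul_ne_zero two_ne_zero hη.ne') hφ)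
      ((gq_diagonal_eq_secular hx hne').symm.trans hlng.1.1) (Ioo_mem_nhds hmem.1 hmem.2)
    exact ⟨t, ht.1, ht.2, htpos⟩
  · rintro ⟨t, hlt, htk, ht⟩
    obtain ⟨hlt, ht0⟩ := max_lt_iff.1 hlt
    have hpos : ∀ i ≠ k, 0 < lam i + t := fun i hi => by linarith [hl i hi]
    obtain ⟨η, htη, hkη, hzero⟩ := exists_secular_eq_zero hk0 (by linarith) hpos hr ht
    have hη : 0 < η := ht0.trans htη
    have hder (s : ℝ) (hs : s ∈ Set.Icc t η) :=
      hasDerivAt_secular (r := r) (c := c) (hne (η := s) (hlt.trans_le hs.1) (by linarith [hs.2]))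
    obtain ⟨ξ, hξ, hslope⟩ := exists_hasDerivAt_eq_slope _ _ htη
      (fun s hs => (hder s hs).continuousAt.continuousWithinAt)
      fun s hs => hder s (Set.Ioo_subset_Icc_self hs)
    have hφξ : ∑ i, r i ^ 2 / (lam i + ξ) ^ 3 < 0 := by
      have hneg : 2 * ξ * ∑ i, r i ^ 2 / (lam i + ξ) ^ 3 < 0 := by
        rw [hslope, hzero]
        exact div_neg_of_neg_of_pos (by linarith) (by linarith)
      have : 0 < 2 * ξ := by linarith [hξ.1]
      exact (pos_iff_neg_of_mul_neg hneg).1 this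
    have hφ : ∑ i, r i ^ 2 / (lam i + η) ^ 3 < 0 :=
      (sum_div_cube_le hξ.2.le hkη fun i hi => by linarith [hpos i hi, hξ.1]).trans_lt hφξ
    have hne' := hne (hlt.trans htη) (by linarith)
    set x : Fin n → ℝ := fun i => -r i / (lam i + η) with hxdef
    have hx (i : Fin n) : (lam i + η) * x i = -r i := mul_div_cancel₀ _ (hne' i)
    have hS : ∑ i, x i ^ 2 / (lam i + η) < 0 := by
      refine lt_of_eq_of_lt (Finset.sum_congr rfl fun i _ => ?_) hφ
      have := hne' i
      simp only [hxdef]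
      field_simp
    have hg : gq (diagonal lam) r c x = 0 := (gq_diagonal_eq_secular hx hne').trans hzero
    refine ⟨x, η⁻¹, (isLNGMinPplus_diagonal_iff hη hx hg).2
      ⟨exists_local_min_radius hη hkη (fun i hi => by linarith [hpos i hi]) hS, ?_⟩,
      inv_pos.2 hη, fun i => ?_⟩
    · have hxk : x k ≠ 0 := fun h => hr (by have := hx k; simp_all)
      have hsum (f : Fin n → ℝ) (hf : ∀ i, i ≠ k → f i = 0) : ∑ i, f i = f k :=
        Fintype.sum_eq_single k hf
      refine ⟨Pi.single k (2 * η * x k / lam k), ?_, ?_⟩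
      · rw [hsum _ fun i hi => by simp [hi], hsum _ fun i hi => by simp [hi]]
        simp only [Pi.single_eq_same]
        have := hk0.ne
        field_simp
      · rw [hsum _ fun i hi => by simp [hi]]
        simp only [Pi.single_eq_same]
        have := hk0.ne
        exact mul_neg_of_neg_of_pos hkη (by positivity)
    · have hηη : η⁻¹ * η = 1 := inv_mul_cancel₀ hη.ne'
      linear_combination η⁻¹ * hx i - x i * hηη

end Diagonal

section ChangeOfBasis

variable {n : ℕ} {A V : Matrix (Fin n) (Fin n) ℝ} {b lam : Fin n → ℝ} {c : ℝ}

theorem mulVec_surjective (hV : Vᵀ * V = 1) : Function.Surjective fun z => V *ᵥ z := fun z =>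
  ⟨Vᵀ *ᵥ z, by simp [mulVec_mulVec, mul_eq_one_comm.1 hV]⟩

theorem dotProduct_mulVec_mulVec (hV : Vᵀ * V = 1) (y z : Fin n → ℝ) :
    V *ᵥ y ⬝ᵥ V *ᵥ z = y ⬝ᵥ z := by
  rw [dotProduct_mulVec, vecMul_mulVec, ← dotProduct_mulVec, hV, one_mulVec]

theorem gq_diagonal_mulVec (hV : Vᵀ * V = 1) (hA : V * A = diagonal lam * V) (y : Fin n → ℝ) :
    gq (diagonal lam) (V *ᵥ b) c (V *ᵥ y) = gq A b c y := by
  rw [gq, gq, mulVec_mulVec, ← hA, ← mulVec_mulVec, dotProduct_mulVec_mulVec hV,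
    dotProduct_mulVec_mulVec hV]

theorem isLNGMinPplus_diagonal_mulVec (hV : Vᵀ * V = 1) (hA : V * A = diagonal lam * V)
    (y : Fin n → ℝ) :
    IsLNGMinPplus (diagonal lam) (V *ᵥ b) c (V *ᵥ y) ↔ IsLNGMinPplus A b c y := by
  have hsurj := mulVec_surjective hV
  rw [IsLNGMinPplus, IsLNGMinPplus, hsurj.forall]
  conv_lhs =>
    enter [1, 2, 1, δ]
    rw [hsurj.forall]
  simp only [← mulVec_sub, euclNorm, gq_diagonal_mulVec hV hA, dotProduct_mulVec_mulVec hV]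

theorem stationary_iff (hV : Vᵀ * V = 1) (hA : V * A = diagonal lam * V) (y : Fin n → ℝ)
    (μ : ℝ) : ((1 : Matrix (Fin n) (Fin n) ℝ) + μ • A) *ᵥ y + μ • b = 0 ↔
      ∀ i, (V *ᵥ y) i + μ * (lam i * (V *ᵥ y) i) + μ * (V *ᵥ b) i = 0 := by
  have hinj : Function.Injective fun z => V *ᵥ z := fun z z' h => by
    simpa [mulVec_mulVec, hV] using congrArg (fun z => Vᵀ *ᵥ z) h
  rw [← hinj.eq_iff, funext_iff]
  refine forall_congr' fun i => ?_
  simp only [mulVec_add, add_mulVec, one_mulVec, smul_mulVec, mulVec_smul, mulVec_zero]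
  rw [mulVec_mulVec, hA, ← mulVec_mulVec]
  simp only [Pi.add_apply, Pi.smul_apply, smul_eq_mul, mulVec_diagonal, Pi.zero_apply]

end ChangeOfBasis

theorem stmt19 {n : ℕ} (hn : 2 ≤ n)
    (A : Matrix (Fin n) (Fin n) ℝ) (hA : A.IsSymm)
    (b : Fin n → ℝ) (c : ℝ)
    (lam : Fin n → ℝ) (hmono : Monotone lam)
    (v : Fin n → Fin n → ℝ)
    (horth : ∀ i j : Fin n, v i ⬝ᵥ v j = if i = j then (1:ℝ) else 0)
    (heig : ∀ i : Fin n, A.mulVec (v i) = lam i • v i)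
    (hint : max (-(lam ⟨1, by omega⟩)) 0 < -(lam ⟨0, by omega⟩))
    (hr : v ⟨0, by omega⟩ ⬝ᵥ b ≠ 0) :
    (∃ (ys : Fin n → ℝ) (μ : ℝ), IsLNGMinPplus A b c ys ∧ 0 < μ ∧
        ((1 : Matrix (Fin n) (Fin n) ℝ) + μ • A).mulVec ys + μ • b = 0) ↔
    (∃ η : ℝ, max (-(lam ⟨1, by omega⟩)) 0 < η ∧ η < -(lam ⟨0, by omega⟩) ∧
        0 < psiOne lam v b c η) := by
  set V : Matrix (Fin n) (Fin n) ℝ := Matrix.of v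
  have hVV : V * Vᵀ = 1 := by
    ext i j
    rw [mul_apply', one_apply]
    exact horth i j
  have hV : Vᵀ * V = 1 := mul_eq_one_comm.1 hVV
  have hVA : V * A = diagonal lam * V := by
    ext i j
    have := congrFun (heig i) j
    rw [diagonal_mul, mul_apply']
    rw [← hA.eq, mulVec_transpose] at this
    exact this
  have hpsi (η : ℝ) : psiOne lam v b c η = secular lam (V *ᵥ b) c η := by
    simp only [psiOne, secular, Finset.sum_sub_distrib]
    rfl
  have hdiag := exists_isLNGMinPplus_diagonal_iff (c := c) (r := V *ᵥ b) (lam := lam)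
    (k := ⟨0, by omega⟩) (l := ⟨1, by omega⟩) (by simp) (fun i => hmono (Nat.zero_le _))
    (fun i hi => hmono (Nat.one_le_iff_ne_zero.2 fun h => hi (Fin.ext h)))
    (by linarith [(max_lt_iff.1 hint).2]) hr
  simp only [hpsi]
  rw [← hdiag, (mulVec_surjective hV).exists (p := fun x => ∃ μ : ℝ,
    IsLNGMinPplus (diagonal lam) (V *ᵥ b) c x ∧ 0 < μ ∧
      ∀ i, x i + μ * (lam i * x i) + μ * (V *ᵥ b) i = 0)]
  simp only [isLNGMinPplus_diagonal_mulVec hV hVA, stationary_iff hV hVA]
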